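/- arXiv:1407.8479 — 2 statements merged into one kernel-verified Lean document; each statement's English description precedes it below -/
import Mathlib

section
/- Let a : ℕ → ℍ with ∑_{n≥0} |aₙ|² < ∞, and let f(q) = ∑_{n≥0} qⁿ aₙ be the corresponding function in H²(𝔹), with Cullen derivative ∂_c f(q) = ∑_{n≥1} n·q^{n−1} aₙ. Then ∑_{n≥0} |aₙ|² = |f(0)|² + (1/π²)·(1/4)·∫_{𝕊} ( ∫_{\{(x,y) ∈ ℝ² : x²+y² < 1\}} |∂_c f(x + yI)|² · log( (x²+y²)^{−1} ) dx dy ) dA_𝕊(I), where dA_𝕊 is the surface area measure on the 2-sphere 𝕊 (total area 4π). Equivalently, ‖f‖²_{H²(𝔹)} = |f(0)|² + (1/Vol(𝔹)) ∫_𝔹 |∂_c f(q)|² log |q|^{−2} dVol_𝔹(q), where dVol_𝔹(x+yI) = (1/4) dA_𝕊(I) dx dy and Vol(𝔹) = π². -/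
open scoped Quaternion ENNReal
open MeasureTheory

/-- The Cullen (slice) derivative of `f(q) = ∑ₙ qⁿ aₙ`, namely
`∂_c f(q) = ∑_{n≥1} n·q^{n−1} aₙ`. -/
noncomputable def cullenDeriv (a : ℕ → ℍ[ℝ]) (q : ℍ[ℝ]) : ℍ[ℝ] :=
  ∑' n : ℕ, ((n + 1 : ℕ) : ℝ) • (q ^ n * a (n + 1))

/-- The identification of `ℝ³` with the imaginary quaternions. -/
def iQ (v : EuclideanSpace ℝ (Fin 3)) : ℍ[ℝ] := ⟨0, v 0, v 1, v 2⟩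

lemma iQ_mul_self (I : Metric.sphere (0 : EuclideanSpace ℝ (Fin 3)) 1) :
    iQ I * iQ I = -1 := by
  have h : (I : EuclideanSpace ℝ (Fin 3)) 0 ^ 2 + (I : EuclideanSpace ℝ (Fin 3)) 1 ^ 2
      + (I : EuclideanSpace ℝ (Fin 3)) 2 ^ 2 = 1 := by
    have := I.2
    rw [mem_sphere_zero_iff_norm, EuclideanSpace.norm_eq, Real.sqrt_eq_one] at this
    simpa [Fin.sum_univ_three] using this
  ext
  · rw [Quaternion.re_mul]
    simp [iQ]
    linarith
  · rw [Quaternion.imI_mul]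
    simp [iQ, mul_comm]
  · rw [Quaternion.imJ_mul]
    simp [iQ, mul_comm]
  · rw [Quaternion.imK_mul]
    simp [iQ, mul_comm]

/-- The point `cos θ + u sin θ` of the slice spanned by `1` and `u`. -/
noncomputable def sliceExp (u : ℍ[ℝ]) (θ : ℝ) : ℍ[ℝ] :=
  (Real.cos θ : ℍ[ℝ]) + Real.sin θ • u

lemma sliceExp_mul {u : ℍ[ℝ]} (hu : u * u = -1) (θ φ : ℝ) :
    sliceExp u θ * sliceExp u φ = sliceExp u (θ + φ) := by
  simp only [sliceExp, Real.cos_add, Real.sin_add, ← Quaternion.coe_mul_eq_smul]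
  simp only [add_mul, mul_add, Quaternion.coe_sub, Quaternion.coe_add, Quaternion.coe_mul]
  have h1 : (Real.sin θ : ℍ[ℝ]) * u * (Real.sin φ * u) = -(Real.sin θ * Real.sin φ) := by
    rw [mul_assoc, ← mul_assoc u, ← (Quaternion.coe_commutes (Real.sin φ) u), mul_assoc _ u u, hu]
    simp
  have h2 : (Real.sin θ : ℍ[ℝ]) * u * Real.cos φ = Real.sin θ * Real.cos φ * u := by
    rw [mul_assoc, ← Quaternion.coe_commutes, mul_assoc]
  rw [h1, h2]
  simp only [← mul_assoc]
  abel

lemma sliceExp_pow {u : ℍ[ℝ]} (hu : u * u = -1) (θ : ℝ) (n : ℕ) :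
    sliceExp u θ ^ n = sliceExp u (n * θ) := by
  induction n with
  | zero => simp [sliceExp]
  | succ k ih => rw [pow_succ, ih, sliceExp_mul hu]; congr 1; push_cast; ring

lemma re_eq_zero_of_mul_self_eq_neg_one {u : ℍ[ℝ]} (hu : u * u = -1) : u.re = 0 := by
  have h0 : (u * u).re = -1 := by rw [hu]; simp
  have h1 : (u * u).imI = 0 := by rw [hu]; simp
  have h2 : (u * u).imJ = 0 := by rw [hu]; simp
  have h3 : (u * u).imK = 0 := by rw [hu]; simp
  simp only [Quaternion.re_mul, Quaternion.imI_mul, Quaternion.imJ_mul, Quaternion.imK_mul]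
    at h0 h1 h2 h3
  by_contra hw
  have hx : u.imI = 0 := mul_left_cancel₀ hw (by linarith)
  have hy : u.imJ = 0 := mul_left_cancel₀ hw (by linarith)
  have hz : u.imK = 0 := mul_left_cancel₀ hw (by linarith)
  rw [hx, hy, hz] at h0
  nlinarith

lemma im_sq_of_mul_self_eq_neg_one {u : ℍ[ℝ]} (hu : u * u = -1) :
    u.imI * u.imI = 1 - u.imJ * u.imJ - u.imK * u.imK := by
  have h : (u * u).re = -1 := by rw [hu]; simp
  rw [Quaternion.re_mul, re_eq_zero_of_mul_self_eq_neg_one hu] at h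
  linarith

lemma norm_sq_coe_add_smul {u : ℍ[ℝ]} (hu : u * u = -1) (x y : ℝ) :
    ‖(x : ℍ[ℝ]) + y • u‖ ^ 2 = x ^ 2 + y ^ 2 := by
  rw [sq, ← Quaternion.normSq_eq_norm_mul_self, Quaternion.normSq_def']
  simp [re_eq_zero_of_mul_self_eq_neg_one hu]
  linear_combination y ^ 2 * im_sq_of_mul_self_eq_neg_one hu

lemma inner_sliceExp_mul {u : ℍ[ℝ]} (hu : u * u = -1) (θ φ : ℝ) (c d : ℍ[ℝ]) :
    inner ℝ (sliceExp u θ * c) (sliceExp u φ * d)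
      = Real.cos (φ - θ) * inner ℝ c d + Real.sin (φ - θ) * inner ℝ c (u * d) := by
  rw [Real.cos_sub, Real.sin_sub]
  simp only [sliceExp, Quaternion.inner_def]
  simp [re_eq_zero_of_mul_self_eq_neg_one hu]
  linear_combination (Real.sin θ * Real.sin φ *
    (c.re * d.re + c.imI * d.imI + c.imJ * d.imJ + c.imK * d.imK)) *
    im_sq_of_mul_self_eq_neg_one hu

lemma norm_sliceExp_mul {u : ℍ[ℝ]} (hu : u * u = -1) (θ : ℝ) (c : ℍ[ℝ]) :
    ‖sliceExp u θ * c‖ = ‖c‖ := by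
  have := inner_sliceExp_mul hu θ θ c c
  simp only [sub_self, Real.cos_zero, Real.sin_zero, one_mul, zero_mul, add_zero,
    real_inner_self_eq_norm_sq] at this
  exact (sq_eq_sq₀ (norm_nonneg _) (norm_nonneg _)).1 this

lemma continuous_sliceExp (u : ℍ[ℝ]) : Continuous (sliceExp u) := by
  unfold sliceExp
  exact (Quaternion.continuous_coe.comp Real.continuous_cos).add
    (Real.continuous_sin.smul continuous_const)

lemma integral_inner_sliceExp_pow_mul {u : ℍ[ℝ]} (hu : u * u = -1) {n m : ℕ} (hnm : n ≠ m)
    (c d : ℍ[ℝ]) :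
    ∫ θ in (-Real.pi)..Real.pi, inner ℝ (sliceExp u θ ^ n * c) (sliceExp u θ ^ m * d) = 0 := by
  have hk : (m - n : ℝ) ≠ 0 := by
    rw [sub_ne_zero]; exact_mod_cast hnm.symm
  have hs : Real.sin ((m - n : ℝ) * Real.pi) = 0 := by
    have := Real.sin_int_mul_pi (m - n); exact_mod_cast this
  simp_rw [sliceExp_pow hu, inner_sliceExp_mul hu, ← sub_mul]
  rw [intervalIntegral.integral_add
    (Continuous.intervalIntegrable (by fun_prop) _ _)
    (Continuous.intervalIntegrable (by fun_prop) _ _),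
    intervalIntegral.integral_mul_const, intervalIntegral.integral_mul_const,
    intervalIntegral.integral_comp_mul_left Real.cos hk,
    intervalIntegral.integral_comp_mul_left Real.sin hk]
  simp [hs]

lemma integral_norm_sq_sum_sliceExp {u : ℍ[ℝ]} (hu : u * u = -1) (c : ℕ → ℍ[ℝ]) (N : ℕ) :
    ∫ θ in (-Real.pi)..Real.pi, ‖∑ n ∈ Finset.range N, sliceExp u θ ^ n * c n‖ ^ 2
      = 2 * Real.pi * ∑ n ∈ Finset.range N, ‖c n‖ ^ 2 := by
  have hc := continuous_sliceExp u
  induction N with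
  | zero => simp
  | succ N ih =>
    have h : ∀ θ, ‖∑ n ∈ Finset.range (N + 1), sliceExp u θ ^ n * c n‖ ^ 2
        = ‖∑ n ∈ Finset.range N, sliceExp u θ ^ n * c n‖ ^ 2
          + 2 * ∑ n ∈ Finset.range N,
              inner ℝ (sliceExp u θ ^ n * c n) (sliceExp u θ ^ N * c N) + ‖c N‖ ^ 2 := by
      intro θ
      rw [Finset.sum_range_succ, norm_add_sq_real, sum_inner, sliceExp_pow hu θ N,
        norm_sliceExp_mul hu]
    simp_rw [h]
    rw [intervalIntegral.integral_add
      (Continuous.intervalIntegrable (by fun_prop) _ _)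
      (Continuous.intervalIntegrable (by fun_prop) _ _), intervalIntegral.integral_add
      (Continuous.intervalIntegrable (by fun_prop) _ _)
      (Continuous.intervalIntegrable (by fun_prop) _ _), ih,
      intervalIntegral.integral_const_mul, intervalIntegral.integral_finsetSum
      (fun _ _ => Continuous.intervalIntegrable (by fun_prop) _ _),
      Finset.sum_eq_zero fun n hn =>
        integral_inner_sliceExp_pow_mul hu (Finset.mem_range.1 hn).ne _ _,
      Finset.sum_range_succ]
    simp
    ring

lemma summable_norm_sq {E : Type*} [SeminormedAddCommGroup E] {c : ℕ → E}
    (hs : Summable fun n => ‖c n‖) : Summable fun n => ‖c n‖ ^ 2 := by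
  refine Summable.of_norm_bounded_eventually_nat hs ?_
  filter_upwards [hs.tendsto_atTop_zero.eventually_le_const one_pos] with n h
  rw [norm_pow, norm_norm]
  exact pow_le_of_le_one (norm_nonneg _) h two_ne_zero

/-- The Parseval identity on a circle of a slice. -/
lemma integral_norm_sq_tsum_sliceExp {u : ℍ[ℝ]} (hu : u * u = -1) {c : ℕ → ℍ[ℝ]}
    (hs : Summable fun n => ‖c n‖) :
    ∫ θ in (-Real.pi)..Real.pi, ‖∑' n, sliceExp u θ ^ n * c n‖ ^ 2
      = 2 * Real.pi * ∑' n, ‖c n‖ ^ 2 := by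
  have hc := continuous_sliceExp u
  have hn : ∀ θ n, ‖sliceExp u θ ^ n * c n‖ = ‖c n‖ := fun θ n => by
    rw [sliceExp_pow hu, norm_sliceExp_mul hu]
  have hsum : ∀ θ, Summable fun n => sliceExp u θ ^ n * c n := fun θ =>
    Summable.of_norm (by simpa only [hn] using hs)
  have h1 := ((summable_norm_sq hs).hasSum.tendsto_sum_nat).const_mul (2 * Real.pi)
  simp_rw [← integral_norm_sq_sum_sliceExp hu] at h1
  refine tendsto_nhds_unique ?_ h1
  refine intervalIntegral.tendsto_integral_filter_of_dominated_convergence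
    (fun _ => (∑' n, ‖c n‖) ^ 2) ?_ ?_ ?_ ?_
  · exact .of_forall fun N => Continuous.aestronglyMeasurable (by fun_prop)
  · refine .of_forall fun N => .of_forall fun θ _ => ?_
    rw [norm_pow, norm_norm]
    gcongr
    refine (norm_sum_le _ _).trans ?_
    simp_rw [hn]
    exact hs.sum_le_tsum _ fun _ _ => norm_nonneg _
  · exact intervalIntegrable_const
  · exact .of_forall fun θ _ => ((hsum θ).hasSum.tendsto_sum_nat.norm).pow 2

lemma integral_pow_mul_log (n : ℕ) :
    ∫ r in (0 : ℝ)..1, r ^ (2 * n + 1) * Real.log ((r ^ 2)⁻¹) = 1 / (2 * (n + 1) ^ 2) := by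
  have e : ∀ r : ℝ, r ^ (2 * n + 1) * Real.log ((r ^ 2)⁻¹)
      = -2 * r ^ (2 * n) * (r * Real.log r) := fun r => by
    rw [Real.log_inv, Real.log_pow]; push_cast; ring
  simp_rw [e]
  have hl := Real.continuous_mul_log
  rw [intervalIntegral.integral_eq_sub_of_hasDerivAt_of_le zero_le_one
    (f := fun r => -(r ^ (2 * n + 1) * (r * Real.log r)) / (n + 1)
      + r ^ (2 * n + 2) / (2 * (n + 1) ^ 2))]
  · simp
  · exact Continuous.continuousOn (by fun_prop)
  · intro r hr
    have h0 : r ≠ 0 := hr.1.ne'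
    have hn : (n + 1 : ℝ) ≠ 0 := by positivity
    have := ((((hasDerivAt_pow (2 * n + 1) r).mul
      ((hasDerivAt_id r).mul (Real.hasDerivAt_log h0))).neg.div_const (n + 1 : ℝ)).add
      ((hasDerivAt_pow (2 * n + 2) r).div_const (2 * (n + 1 : ℝ) ^ 2)))
    refine this.congr_deriv ?_
    simp
    field_simp
    ring
  · exact Continuous.intervalIntegrable (by fun_prop) _ _

lemma continuous_norm_sq_tsum_sliceExp {u : ℍ[ℝ]} (hu : u * u = -1) {c : ℕ → ℍ[ℝ]}
    (hs : Summable fun n => ‖c n‖) :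
    Continuous fun θ => ‖∑' n, sliceExp u θ ^ n * c n‖ ^ 2 := by
  have hc := continuous_sliceExp u
  refine ((continuous_tsum (fun n => by fun_prop) hs fun n θ => ?_).norm).pow 2
  rw [sliceExp_pow hu, norm_sliceExp_mul hu]

lemma summable_norm_cullenDeriv_terms {a : ℕ → ℍ[ℝ]} (ha : Summable fun n => ‖a n‖ ^ 2) {q : ℍ[ℝ]}
    (hq : ‖q‖ < 1) :
    Summable fun n : ℕ => ‖((n + 1 : ℕ) : ℝ) • (q ^ n * a (n + 1))‖ := by
  have h1 : Summable fun n : ℕ => ((n : ℝ) ^ 1 * ‖q‖ ^ n + ‖q‖ ^ n) :=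
    (summable_pow_mul_geometric_of_norm_lt_one 1 (by rwa [norm_norm])).add
      (summable_geometric_of_lt_one (norm_nonneg _) hq)
  refine Summable.of_norm_bounded_eventually_nat h1 ?_
  have h2 := (ha.tendsto_atTop_zero.comp (Filter.tendsto_add_atTop_nat 1)).eventually_le_const
    one_pos
  filter_upwards [h2] with n hn
  have h3 : ‖a (n + 1)‖ ≤ 1 := by
    simpa using hn
  rw [norm_norm, norm_smul, norm_mul, norm_pow, Real.norm_natCast]
  calc ((n + 1 : ℕ) : ℝ) * (‖q‖ ^ n * ‖a (n + 1)‖) ≤ ((n + 1 : ℕ) : ℝ) * (‖q‖ ^ n * 1) := by gcongr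
    _ = _ := by push_cast; ring

lemma measurableSet_disk : MeasurableSet {p : ℝ × ℝ | p.1 ^ 2 + p.2 ^ 2 < 1} :=
  (isOpen_lt (by fun_prop) (by fun_prop)).measurableSet

lemma norm_coe_add_smul_lt_one {u : ℍ[ℝ]} (hu : u * u = -1) {p : ℝ × ℝ}
    (hp : p.1 ^ 2 + p.2 ^ 2 < 1) : ‖(p.1 : ℍ[ℝ]) + p.2 • u‖ < 1 := by
  rw [← norm_sq_coe_add_smul hu] at hp
  nlinarith [norm_nonneg ((p.1 : ℍ[ℝ]) + p.2 • u)]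

lemma stronglyMeasurable_indicator_cullenDeriv {a : ℕ → ℍ[ℝ]} (ha : Summable fun n => ‖a n‖ ^ 2)
    {u : ℍ[ℝ]} (hu : u * u = -1) :
    StronglyMeasurable ({p : ℝ × ℝ | p.1 ^ 2 + p.2 ^ 2 < 1}.indicator
      fun p => cullenDeriv a ((p.1 : ℍ[ℝ]) + p.2 • u)) := by
  have hco : Continuous fun p : ℝ × ℝ => (p.1 : ℍ[ℝ]) + p.2 • u :=
    (Quaternion.continuous_coe.comp continuous_fst).add (continuous_snd.smul continuous_const)
  refine stronglyMeasurable_of_tendsto Filter.atTop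
    (f := fun N => {p : ℝ × ℝ | p.1 ^ 2 + p.2 ^ 2 < 1}.indicator fun p =>
      ∑ n ∈ Finset.range N, ((n + 1 : ℕ) : ℝ) • (((p.1 : ℍ[ℝ]) + p.2 • u) ^ n * a (n + 1))) ?_ ?_
  · intro N
    exact (Continuous.stronglyMeasurable (by fun_prop)).indicator measurableSet_disk
  · rw [tendsto_pi_nhds]
    intro p
    by_cases hp : p ∈ {p : ℝ × ℝ | p.1 ^ 2 + p.2 ^ 2 < 1}
    · simp only [Set.indicator_of_mem hp]
      exact (summable_norm_cullenDeriv_terms ha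
        (norm_coe_add_smul_lt_one hu hp)).of_norm.hasSum.tendsto_sum_nat
    · simp only [Set.indicator_of_notMem hp]
      exact tendsto_const_nhds

lemma lintegral_circle_norm_sq_cullenDeriv {a : ℕ → ℍ[ℝ]} (ha : Summable fun n => ‖a n‖ ^ 2)
    {u : ℍ[ℝ]} (hu : u * u = -1) {r : ℝ} (hr : r ∈ Set.Ioo (0 : ℝ) 1) :
    ∫⁻ θ in Set.Ioo (-Real.pi) Real.pi,
        ENNReal.ofReal (‖cullenDeriv a (r • sliceExp u θ)‖ ^ 2)
      = ∑' n : ℕ, ENNReal.ofReal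
          (2 * Real.pi * ((n + 1) ^ 2 * r ^ (2 * n) * ‖a (n + 1)‖ ^ 2)) := by
  set c : ℕ → ℍ[ℝ] := fun n => (((n + 1 : ℕ) : ℝ) * r ^ n) • a (n + 1) with hc
  have hs : Summable fun n => ‖c n‖ := by
    have hr' : ‖(r : ℍ[ℝ])‖ < 1 := by
      rw [Quaternion.norm_coe, Real.norm_of_nonneg hr.1.le]; exact hr.2
    refine (summable_norm_cullenDeriv_terms ha hr').congr fun n => ?_
    rw [← Quaternion.coe_pow, Quaternion.coe_mul_eq_smul, smul_smul]
  have hcd : ∀ θ, cullenDeriv a (r • sliceExp u θ) = ∑' n, sliceExp u θ ^ n * c n := fun θ => by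
    refine tsum_congr fun n => ?_
    rw [hc, smul_pow, smul_mul_assoc, mul_smul_comm, mul_smul]
  have hn : ∀ n, ‖c n‖ ^ 2 = (n + 1) ^ 2 * r ^ (2 * n) * ‖a (n + 1)‖ ^ 2 := fun n => by
    rw [hc, norm_smul, mul_pow, Real.norm_eq_abs, sq_abs]
    push_cast
    ring
  simp_rw [hcd, ← hn]
  have hcont := continuous_norm_sq_tsum_sliceExp hu hs
  rw [← ofReal_integral_eq_lintegral_ofReal
    ((hcont.integrableOn_Icc (a := -Real.pi) (b := Real.pi)).mono_set Set.Ioo_subset_Icc_self)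
    (.of_forall fun θ => by positivity), ← integral_Ioc_eq_integral_Ioo,
    ← intervalIntegral.integral_of_le (by linarith [Real.pi_pos]),
    integral_norm_sq_tsum_sliceExp hu hs, ← tsum_mul_left,
    ENNReal.ofReal_tsum_of_nonneg (fun n => by positivity)
      ((summable_norm_sq hs).mul_left _)]

lemma lintegral_pow_mul_log (n : ℕ) :
    ∫⁻ r in Set.Ioo (0 : ℝ) 1, ENNReal.ofReal (r ^ (2 * n + 1) * Real.log ((r ^ 2)⁻¹))
      = ENNReal.ofReal (1 / (2 * (n + 1) ^ 2)) := by
  have e : ∀ r : ℝ, r ^ (2 * n + 1) * Real.log ((r ^ 2)⁻¹)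
      = -2 * r ^ (2 * n) * (r * Real.log r) := fun r => by
    rw [Real.log_inv, Real.log_pow]; push_cast; ring
  have hcont : Continuous fun r : ℝ => r ^ (2 * n + 1) * Real.log ((r ^ 2)⁻¹) := by
    have hl := Real.continuous_mul_log
    simp_rw [e]
    fun_prop
  rw [← ofReal_integral_eq_lintegral_ofReal
    ((hcont.integrableOn_Icc (a := 0) (b := 1)).mono_set Set.Ioo_subset_Icc_self),
    ← integral_Ioc_eq_integral_Ioo, ← intervalIntegral.integral_of_le zero_le_one,
    integral_pow_mul_log]
  filter_upwards [ae_restrict_mem measurableSet_Ioo] with r hr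
  have h1 : r ^ 2 ≤ 1 := pow_le_one₀ hr.1.le hr.2.le
  have h0 : 0 < r := hr.1
  exact mul_nonneg (by positivity) (Real.log_nonneg ((one_le_inv₀ (by positivity)).2 h1))

lemma lintegral_slice {a : ℕ → ℍ[ℝ]} (ha : Summable fun n => ‖a n‖ ^ 2)
    {u : ℍ[ℝ]} (hu : u * u = -1) :
    ∫⁻ p in {p : ℝ × ℝ | p.1 ^ 2 + p.2 ^ 2 < 1},
        ENNReal.ofReal (‖cullenDeriv a ((p.1 : ℍ[ℝ]) + p.2 • u)‖ ^ 2 *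
          Real.log ((p.1 ^ 2 + p.2 ^ 2)⁻¹))
      = ENNReal.ofReal (Real.pi * ∑' n, ‖a (n + 1)‖ ^ 2) := by
  set D := {p : ℝ × ℝ | p.1 ^ 2 + p.2 ^ 2 < 1} with hD
  set g := D.indicator fun p => cullenDeriv a ((p.1 : ℍ[ℝ]) + p.2 • u) with hg
  have hgm : StronglyMeasurable g := stronglyMeasurable_indicator_cullenDeriv ha hu
  set h : ℝ × ℝ → ℝ≥0∞ := fun p =>
    ENNReal.ofReal (‖g p‖ ^ 2 * Real.log ((p.1 ^ 2 + p.2 ^ 2)⁻¹)) with hh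
  have hhm : Measurable h := by
    refine ((hgm.norm.measurable.pow_const 2).mul ?_).ennreal_ofReal
    fun_prop
  have h1 : ∫⁻ p in D, ENNReal.ofReal (‖cullenDeriv a ((p.1 : ℍ[ℝ]) + p.2 • u)‖ ^ 2 *
          Real.log ((p.1 ^ 2 + p.2 ^ 2)⁻¹)) = ∫⁻ p, h p := by
    rw [← lintegral_indicator (s := D) measurableSet_disk]
    refine lintegral_congr fun p => ?_
    by_cases hp : p ∈ D
    · simp only [hh, hg, Set.indicator_of_mem hp]
    · simp [hh, hg, Set.indicator_of_notMem hp]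
  have h2 : ∀ r ∈ Set.Ioi (0 : ℝ), ∫⁻ θ in Set.Ioo (-Real.pi) Real.pi,
      ENNReal.ofReal r * h (r * Real.cos θ, r * Real.sin θ)
      = (Set.Ioo (0 : ℝ) 1).indicator (fun r => ∑' n : ℕ, ENNReal.ofReal
          (2 * Real.pi * ((n + 1) ^ 2 * ‖a (n + 1)‖ ^ 2)) *
          ENNReal.ofReal (r ^ (2 * n + 1) * Real.log ((r ^ 2)⁻¹))) r := by
    intro r hr
    have hr0 : 0 < r := hr
    have hsq : ∀ θ, (r * Real.cos θ) ^ 2 + (r * Real.sin θ) ^ 2 = r ^ 2 := fun θ => by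
      linear_combination r ^ 2 * Real.cos_sq_add_sin_sq θ
    by_cases hr1 : r < 1
    · have hL : 0 ≤ Real.log ((r ^ 2)⁻¹) :=
        Real.log_nonneg ((one_le_inv₀ (by positivity)).2 (pow_le_one₀ hr0.le hr1.le))
      have hmem : ∀ θ, (r * Real.cos θ, r * Real.sin θ) ∈ D := fun θ => by
        rw [hD, Set.mem_ofPred_eq, hsq]
        exact pow_lt_one₀ hr0.le hr1 two_ne_zero
      have hpt : ∀ θ, ENNReal.ofReal r * h (r * Real.cos θ, r * Real.sin θ)
          = ENNReal.ofReal (r * Real.log ((r ^ 2)⁻¹)) *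
            ENNReal.ofReal (‖cullenDeriv a (r • sliceExp u θ)‖ ^ 2) := fun θ => by
        have hq : ((r * Real.cos θ : ℝ) : ℍ[ℝ]) + (r * Real.sin θ) • u = r • sliceExp u θ := by
          rw [sliceExp, smul_add, mul_smul, Quaternion.smul_coe]
        simp only [hh, hg]
        rw [Set.indicator_of_mem (hmem θ), hsq, ← ENNReal.ofReal_mul hr0.le,
          ← ENNReal.ofReal_mul (by positivity), hq]
        congr 1
        ring
      simp_rw [hpt]
      rw [lintegral_const_mul' _ _ ENNReal.ofReal_ne_top,
        lintegral_circle_norm_sq_cullenDeriv ha hu ⟨hr0, hr1⟩,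
        Set.indicator_of_mem (Set.mem_Ioo.2 ⟨hr0, hr1⟩),
        ← ENNReal.tsum_mul_left]
      refine tsum_congr fun n => ?_
      rw [← ENNReal.ofReal_mul (by positivity), ← ENNReal.ofReal_mul (by positivity)]
      congr 1
      ring
    · rw [Set.indicator_of_notMem fun hm => hr1 hm.2]
      refine lintegral_eq_zero_of_ae_eq_zero (.of_forall fun θ => ?_)
      have : (r * Real.cos θ, r * Real.sin θ) ∉ D := by
        rw [hD, Set.mem_ofPred_eq, hsq, not_lt]
        exact one_le_pow₀ (not_lt.1 hr1)
      simp [hh, hg, Set.indicator_of_notMem this]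
  rw [h1, ← lintegral_comp_polarCoord_symm, polarCoord_target, Measure.volume_eq_prod,
    ← Measure.prod_restrict, lintegral_prod _ (by
      refine Measurable.aemeasurable ?_
      refine measurable_fst.ennreal_ofReal.smul (hhm.comp ?_)
      exact continuous_polarCoord_symm.measurable)]
  simp only [polarCoord_symm_apply, smul_eq_mul]
  rw [setLIntegral_congr_fun measurableSet_Ioi h2, setLIntegral_indicator measurableSet_Ioo,
    Set.inter_eq_left.2 fun x hx => hx.1, lintegral_tsum fun n => by fun_prop, ← tsum_mul_left,
    ENNReal.ofReal_tsum_of_nonneg (fun n => by positivity)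
      (((summable_nat_add_iff 1).2 ha).mul_left _)]
  refine tsum_congr fun n => ?_
  rw [lintegral_const_mul' _ _ ENNReal.ofReal_ne_top, lintegral_pow_mul_log,
    ← ENNReal.ofReal_mul (by positivity)]
  congr 1
  field_simp

lemma integral_slice {a : ℕ → ℍ[ℝ]} (ha : Summable fun n => ‖a n‖ ^ 2)
    {u : ℍ[ℝ]} (hu : u * u = -1) :
    ∫ p in {p : ℝ × ℝ | p.1 ^ 2 + p.2 ^ 2 < 1},
        ‖cullenDeriv a ((p.1 : ℍ[ℝ]) + p.2 • u)‖ ^ 2 * Real.log ((p.1 ^ 2 + p.2 ^ 2)⁻¹)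
      = Real.pi * ∑' n, ‖a (n + 1)‖ ^ 2 := by
  have hm := ((aestronglyMeasurable_indicator_iff (μ := volume) measurableSet_disk).1
    (stronglyMeasurable_indicator_cullenDeriv ha hu).aestronglyMeasurable)
  have hl : Measurable fun p : ℝ × ℝ => Real.log ((p.1 ^ 2 + p.2 ^ 2)⁻¹) := by fun_prop
  rw [integral_eq_lintegral_of_nonneg_ae ?_ ?_,
    lintegral_slice ha hu, ENNReal.toReal_ofReal]
  · exact mul_nonneg Real.pi_pos.le (tsum_nonneg fun n => by positivity)
  · filter_upwards [ae_restrict_mem measurableSet_disk] with p hp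
    have hp' : p.1 ^ 2 + p.2 ^ 2 < 1 := hp
    refine mul_nonneg (by positivity) ?_
    rw [Real.log_inv, neg_nonneg]
    exact Real.log_nonpos (by positivity) hp'.le
  · exact (hm.norm.pow 2).mul hl.aestronglyMeasurable

/-- **Littlewood–Paley identity for `H²(𝔹)`.**
For `f(q) = ∑ₙ qⁿ aₙ` with `∑ₙ |aₙ|² < ∞`,
`‖f‖²_{H²(𝔹)} = |f(0)|² + (1/Vol(𝔹)) ∫_𝔹 |∂_c f(q)|² log|q|⁻² dVol_𝔹(q)`,
where `dVol_𝔹(x+yI) = (1/4) dA_𝕊(I) dx dy` in slice coordinates, `dA_𝕊` is the surface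
area measure on the 2-sphere `𝕊` of imaginary units (total area `4π`, realized as the
unit sphere of `ℝ³`), and `Vol(𝔹) = π²`. -/
theorem hardy_norm_eq_log_integral (a : ℕ → ℍ[ℝ]) (ha : Summable fun n => ‖a n‖ ^ 2) :
    ∑' n : ℕ, ‖a n‖ ^ 2
      = ‖a 0‖ ^ 2 + (1 / Real.pi ^ 2) * ((1 / 4) *
          ∫ I : Metric.sphere (0 : EuclideanSpace ℝ (Fin 3)) 1,
            (∫ p in {p : ℝ × ℝ | p.1 ^ 2 + p.2 ^ 2 < 1},
              ‖cullenDeriv a ((p.1 : ℍ[ℝ]) + p.2 • iQ (I : EuclideanSpace ℝ (Fin 3)))‖ ^ 2 *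
                Real.log ((p.1 ^ 2 + p.2 ^ 2)⁻¹) ∂(volume : Measure (ℝ × ℝ)))
            ∂((volume : Measure (EuclideanSpace ℝ (Fin 3))).toSphere)) := by
  simp_rw [integral_slice ha (iQ_mul_self _)]
  rw [integral_const, Measure.toSphere_real_apply_univ, measureReal_def,
    EuclideanSpace.volume_ball_fin_three, ha.tsum_eq_zero_add]
  have hpi := Real.pi_pos
  simp [ENNReal.toReal_ofReal (show 0 ≤ Real.pi * 4 / 3 by positivity)]
  field_simp
end

section
/- Let f ∈ H²(𝔹) and assume that for every I ∈ 𝕊 the radial limits f_I*(θ) = lim_{r→1⁻} f(r·e^{Iθ}) exist for almost every θ ∈ ℝ. If ‖f‖_{BMOA(𝔹_I)} < ∞ for some I ∈ 𝕊, then ‖f‖_{BMOA(𝔹)} < ∞; moreover ‖f‖_{BMOA(𝔹_I)} ≤ ‖f‖_{BMOA(𝔹)} ≤ 2·‖f‖_{BMOA(𝔹_I)}. -/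
open scoped Quaternion ENNReal Topology
open MeasureTheory Filter

/-- `e^{Iθ} = cos θ + I sin θ` for an imaginary unit `I`. -/
noncomputable def expQ (I : ℍ[ℝ]) (θ : ℝ) : ℍ[ℝ] := Real.cos θ • (1 : ℍ[ℝ]) + Real.sin θ • I

/-- The BMO seminorm of a function `g : ℝ → ℍ`. -/
noncomputable def bmoSeminorm (g : ℝ → ℍ[ℝ]) : ℝ≥0∞ :=
  ⨆ (α : ℝ) (β : ℝ) (_ : α < β) (_ : β - α ≤ 2 * Real.pi),
    ENNReal.ofReal
      (((β - α)⁻¹ * ∫ θ in α..β, ‖g θ - (β - α)⁻¹ • ∫ t in α..β, g t‖ ^ 2) ^ (1 / 2 : ℝ))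

theorem imaginaryUnit_mul_self {I : ℍ[ℝ]} (hre : I.re = 0) (hI : ‖I‖ = 1) : I * I = -1 := by
  have h : I * star I = 1 := by
    rw [Quaternion.self_mul_star, Quaternion.normSq_eq_norm_mul_self, hI]; simp
  rw [Quaternion.star_eq_neg.mpr hre, mul_neg] at h
  rw [← h, neg_neg]

theorem expQ_pow {I : ℍ[ℝ]} (h : I * I = -1) (θ : ℝ) (n : ℕ) : expQ I θ ^ n = expQ I (n * θ) := by
  induction n with
  | zero => simp [expQ]
  | succ n ih =>
    rw [pow_succ, ih]
    have : ((n + 1 : ℕ) : ℝ) * θ = n * θ + θ := by push_cast; ring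
    rw [this]
    simp only [expQ, Real.cos_add, Real.sin_add, add_mul, mul_add, smul_mul_assoc, mul_smul_comm,
      one_mul, mul_one, h]
    module

theorem inner_expQ_mul {I : ℍ[ℝ]} (hre : I.re = 0) (hI : ‖I‖ = 1) (s t : ℝ) (x y : ℍ[ℝ]) :
    inner ℝ (expQ I s * x) (expQ I t * y) =
      Real.cos (s - t) * inner ℝ x y + Real.sin (s - t) * inner ℝ (I * x) y := by
  have h : I * I = -1 := imaginaryUnit_mul_self hre hI
  have hs : star I = -I := Quaternion.star_eq_neg.mpr hre
  have h2 : inner ℝ x (I * y) = - inner ℝ (I * x) y := by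
    simp [Quaternion.inner_def, hre]; ring
  have h1 : inner ℝ (I * x) (I * y) = inner ℝ x y := by
    have h3 : inner ℝ (I * x) (I * y) = - inner ℝ (I * (I * x)) y := by
      simp [Quaternion.inner_def, hre]; ring
    rw [h3, ← mul_assoc, h]; simp
  simp only [expQ, add_mul, smul_mul_assoc, one_mul, inner_add_left, inner_add_right,
    real_inner_smul_left, real_inner_smul_right, h1, h2, Real.cos_sub, Real.sin_sub]
  ring

theorem norm_expQ {I : ℍ[ℝ]} (hre : I.re = 0) (hI : ‖I‖ = 1) (θ : ℝ) : ‖expQ I θ‖ = 1 := by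
  have := inner_expQ_mul hre hI θ θ 1 1
  simp only [mul_one, sub_self, Real.cos_zero, Real.sin_zero, zero_mul, add_zero, one_mul,
    real_inner_self_eq_norm_sq, norm_one] at this
  nlinarith [norm_nonneg (expQ I θ)]

theorem continuous_expQ (I : ℍ[ℝ]) : Continuous (expQ I) := by
  unfold expQ; fun_prop

theorem integral_cos_int_mul_period {k : ℤ} (hk : k ≠ 0) (c : ℝ) :
    ∫ θ in c..c + 2 * Real.pi, Real.cos (k * θ) = 0 := by
  have hk' : (k : ℝ) ≠ 0 := by exact_mod_cast hk
  rw [intervalIntegral.integral_comp_mul_left _ hk', integral_cos, mul_add,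
    Real.sin_add_int_mul_two_pi, sub_self, smul_zero]


theorem integral_sin_int_mul_period {k : ℤ} (hk : k ≠ 0) (c : ℝ) :
    ∫ θ in c..c + 2 * Real.pi, Real.sin (k * θ) = 0 := by
  have hk' : (k : ℝ) ≠ 0 := by exact_mod_cast hk
  rw [intervalIntegral.integral_comp_mul_left _ hk', integral_sin, mul_add,
    Real.cos_add_int_mul_two_pi, sub_self, smul_zero]

theorem integral_inner_expQ_mul {I : ℍ[ℝ]} (hre : I.re = 0) (hI : ‖I‖ = 1) (m n : ℕ)
    (x y : ℍ[ℝ]) (c : ℝ) :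
    ∫ θ in c..c + 2 * Real.pi, inner ℝ (expQ I (m * θ) * x) (expQ I (n * θ) * y) =
      if m = n then 2 * Real.pi * inner ℝ x y else 0 := by
  simp only [inner_expQ_mul hre hI]
  split_ifs with h
  · simp [h]
  · have hk : (m : ℤ) - n ≠ 0 := by omega
    have hcast : ∀ θ : ℝ, (m : ℝ) * θ - n * θ = (((m : ℤ) - n : ℤ) : ℝ) * θ := by
      intro θ; push_cast; ring
    simp only [hcast]
    rw [intervalIntegral.integral_add (Continuous.intervalIntegrable (by fun_prop) _ _)
      (Continuous.intervalIntegrable (by fun_prop) _ _),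
      intervalIntegral.integral_mul_const, intervalIntegral.integral_mul_const,
      integral_cos_int_mul_period hk, integral_sin_int_mul_period hk]
    simp

/-- Parseval's identity for polynomials on the slice of `I`, over any period. -/
theorem integral_norm_sq_sum_expQ_mul {I : ℍ[ℝ]} (hre : I.re = 0) (hI : ‖I‖ = 1) (N : ℕ)
    (b : ℕ → ℍ[ℝ]) (c : ℝ) :
    ∫ θ in c..c + 2 * Real.pi, ‖∑ n ∈ Finset.range N, expQ I (n * θ) * b n‖ ^ 2 =
      2 * Real.pi * ∑ n ∈ Finset.range N, ‖b n‖ ^ 2 := by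
  have hc := continuous_expQ I
  simp only [← real_inner_self_eq_norm_sq, sum_inner, inner_sum]
  rw [intervalIntegral.integral_finsetSum
    fun i _ => Continuous.intervalIntegrable (by fun_prop) _ _, Finset.mul_sum]
  refine Finset.sum_congr rfl fun i hi => ?_
  rw [intervalIntegral.integral_finsetSum
    fun i _ => Continuous.intervalIntegrable (by fun_prop) _ _]
  simp only [integral_inner_expQ_mul hre hI]
  rw [Finset.sum_ite_eq', if_pos hi]

theorem smul_expQ_pow_mul {I : ℍ[ℝ]} (hre : I.re = 0) (hI : ‖I‖ = 1) (r θ : ℝ) (n : ℕ)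
    (x : ℍ[ℝ]) : (r • expQ I θ) ^ n * x = expQ I (n * θ) * (r ^ n • x) := by
  rw [smul_pow, expQ_pow (imaginaryUnit_mul_self hre hI), smul_mul_assoc, mul_smul_comm]

theorem eLpNorm_sum_smul_expQ_pow_mul_le {I : ℍ[ℝ]} (hre : I.re = 0) (hI : ‖I‖ = 1)
    {a : ℕ → ℍ[ℝ]} (ha : Summable fun n => ‖a n‖ ^ 2) {r : ℝ} (hr0 : 0 ≤ r) (hr1 : r ≤ 1)
    (N : ℕ) (c : ℝ) :
    eLpNorm (fun θ => ∑ n ∈ Finset.range N, (r • expQ I θ) ^ n * a n) 2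
        (volume.restrict (Set.Ioc c (c + 2 * Real.pi))) ≤
      ENNReal.ofReal ((2 * Real.pi * ∑' n, ‖a n‖ ^ 2) ^ (2 : ℝ)⁻¹) := by
  have hcI := continuous_expQ I
  have hcont : Continuous fun θ => ∑ n ∈ Finset.range N, (r • expQ I θ) ^ n * a n := by fun_prop
  have hmem : MemLp (fun θ => ∑ n ∈ Finset.range N, (r • expQ I θ) ^ n * a n) 2
      (volume.restrict (Set.Ioc c (c + 2 * Real.pi))) :=
    (memLp_two_iff_integrable_sq_norm hcont.aestronglyMeasurable).mpr
      ((by fun_prop : Continuous _).integrableOn_Ioc)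
  rw [hmem.eLpNorm_eq_integral_rpow_norm two_ne_zero ENNReal.ofNat_ne_top]
  simp only [ENNReal.toReal_ofNat, Real.rpow_two]
  refine ENNReal.ofReal_le_ofReal (Real.rpow_le_rpow (by positivity) ?_ (by positivity))
  rw [← intervalIntegral.integral_of_le (by linarith [Real.pi_pos])]
  simp only [smul_expQ_pow_mul hre hI]
  rw [integral_norm_sq_sum_expQ_mul hre hI]
  gcongr
  refine (Finset.sum_le_sum fun n _ => ?_).trans
    (ha.sum_le_tsum (Finset.range N) fun _ _ => by positivity)
  gcongr
  rw [norm_smul, Real.norm_of_nonneg (by positivity)]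
  exact mul_le_of_le_one_left (norm_nonneg _) (pow_le_one₀ hr0 hr1)

theorem summable_smul_expQ_pow_mul {I : ℍ[ℝ]} (hre : I.re = 0) (hI : ‖I‖ = 1)
    {a : ℕ → ℍ[ℝ]} (ha : Summable fun n => ‖a n‖ ^ 2) {r : ℝ} (hr0 : 0 ≤ r) (hr1 : r < 1)
    (θ : ℝ) : Summable fun n => (r • expQ I θ) ^ n * a n := by
  refine Summable.of_norm_bounded ((summable_geometric_of_lt_one hr0 hr1).add ha) fun n => ?_
  rw [norm_mul, norm_pow, norm_smul, norm_expQ hre hI, mul_one, Real.norm_of_nonneg hr0]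
  have h0 : 0 ≤ r ^ n := by positivity
  have h1 : r ^ n ≤ 1 := pow_le_one₀ hr0 hr1.le
  nlinarith [norm_nonneg (a n), sq_nonneg (‖a n‖ - 1), sq_nonneg (r ^ n - ‖a n‖)]

/-- The radial boundary function of an `H²` function is square integrable over every period. -/
theorem memLp_two_of_radial_limit {I : ℍ[ℝ]} (hre : I.re = 0) (hI : ‖I‖ = 1)
    {a : ℕ → ℍ[ℝ]} (ha : Summable fun n => ‖a n‖ ^ 2) {g : ℝ → ℍ[ℝ]}
    (hg : ∀ᵐ θ ∂(volume : Measure ℝ),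
      Tendsto (fun r : ℝ => ∑' n : ℕ, (r • expQ I θ) ^ n * a n) (𝓝[<] (1 : ℝ)) (𝓝 (g θ)))
    (c : ℝ) : MemLp g 2 (volume.restrict (Set.Ioc c (c + 2 * Real.pi))) := by
  obtain ⟨r, -, hr, hlim⟩ := exists_seq_strictMono_tendsto' (zero_lt_one' ℝ)
  have hlim' : Tendsto r atTop (𝓝[<] 1) :=
    tendsto_nhdsWithin_iff.mpr ⟨hlim, .of_forall fun k => (hr k).2⟩
  have hpartial (k : ℕ) (θ : ℝ) :
      Tendsto (fun N => ∑ n ∈ Finset.range N, (r k • expQ I θ) ^ n * a n) atTop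
        (𝓝 (∑' n, (r k • expQ I θ) ^ n * a n)) :=
    (summable_smul_expQ_pow_mul hre hI ha (hr k).1.le (hr k).2 θ).hasSum.tendsto_sum_nat
  have hcI := continuous_expQ I
  have hmeas_sum (k N : ℕ) : AEStronglyMeasurable
      (fun θ => ∑ n ∈ Finset.range N, (r k • expQ I θ) ^ n * a n)
      (volume.restrict (Set.Ioc c (c + 2 * Real.pi))) :=
    (by fun_prop : Continuous _).aestronglyMeasurable
  have hmeas (k : ℕ) : AEStronglyMeasurable (fun θ => ∑' n, (r k • expQ I θ) ^ n * a n)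
      (volume.restrict (Set.Ioc c (c + 2 * Real.pi))) :=
    aestronglyMeasurable_of_tendsto_ae atTop (hmeas_sum k) (.of_forall (hpartial k))
  have hae : ∀ᵐ θ ∂(volume.restrict (Set.Ioc c (c + 2 * Real.pi))),
      Tendsto (fun k => ∑' n, (r k • expQ I θ) ^ n * a n) atTop (𝓝 (g θ)) :=
    (ae_restrict_of_ae hg).mono fun θ h => h.comp hlim'
  have hbound (k : ℕ) := (Lp.eLpNorm_lim_le_liminf_eLpNorm (p := 2) (hmeas_sum k) _
    (.of_forall (hpartial k))).trans (liminf_le_of_frequently_le' (.of_forall fun N =>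
      eLpNorm_sum_smul_expQ_pow_mul_le hre hI ha (hr k).1.le (hr k).2.le N c))
  exact ⟨aestronglyMeasurable_of_tendsto_ae atTop hmeas hae,
    ((Lp.eLpNorm_lim_le_liminf_eLpNorm hmeas g hae).trans
      (liminf_le_of_frequently_le' (.of_forall hbound))).trans_lt ENNReal.ofReal_lt_top⟩

theorem expQ_eq_mul_add_mul {J : ℍ[ℝ]} (hJ : J * J = -1) (I : ℍ[ℝ]) (θ : ℝ) :
    expQ I θ = (2⁻¹ : ℝ) • (1 - I * J) * expQ J θ + (2⁻¹ : ℝ) • (1 + I * J) * expQ J (-θ) := by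
  simp only [expQ, Real.cos_neg, Real.sin_neg, sub_mul, add_mul, mul_add, smul_mul_assoc,
    mul_smul_comm, one_mul, mul_one, mul_assoc, hJ, mul_neg]
  module

/-- The representation formula for the radial boundary functions of two slices. -/
theorem radial_limit_representation {I J : ℍ[ℝ]} (hIre : I.re = 0) (hI : ‖I‖ = 1)
    (hJre : J.re = 0) (hJ : ‖J‖ = 1) {a : ℕ → ℍ[ℝ]} (ha : Summable fun n => ‖a n‖ ^ 2)
    {g h : ℝ → ℍ[ℝ]}
    (hh : ∀ᵐ θ ∂(volume : Measure ℝ),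
      Tendsto (fun r : ℝ => ∑' n : ℕ, (r • expQ I θ) ^ n * a n) (𝓝[<] (1 : ℝ)) (𝓝 (h θ)))
    (hg : ∀ᵐ θ ∂(volume : Measure ℝ),
      Tendsto (fun r : ℝ => ∑' n : ℕ, (r • expQ J θ) ^ n * a n) (𝓝[<] (1 : ℝ)) (𝓝 (g θ))) :
    h =ᵐ[volume] fun θ =>
      (2⁻¹ : ℝ) • (1 - I * J) * g θ + (2⁻¹ : ℝ) • (1 + I * J) * g (-θ) := by
  have hg' := (Measure.measurePreserving_neg (volume : Measure ℝ)).quasiMeasurePreserving.ae hg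
  filter_upwards [hh, hg, hg'] with θ h1 h2 h3
  refine tendsto_nhds_unique h1 (((h2.const_mul ((2⁻¹ : ℝ) • (1 - I * J))).add
    (h3.const_mul ((2⁻¹ : ℝ) • (1 + I * J)))).congr' ?_)
  filter_upwards [Ioo_mem_nhdsLT (zero_lt_one' ℝ)] with r hr
  have hs (t : ℝ) := summable_smul_expQ_pow_mul hJre hJ ha hr.1.le hr.2 t
  rw [← (hs θ).tsum_mul_left, ← (hs (-θ)).tsum_mul_left,
    ← ((hs θ).mul_left _).tsum_add ((hs (-θ)).mul_left _)]
  refine tsum_congr fun n => ?_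
  rw [smul_expQ_pow_mul hIre hI, smul_expQ_pow_mul hJre hJ, smul_expQ_pow_mul hJre hJ,
    expQ_eq_mul_add_mul (imaginaryUnit_mul_self hJre hJ) I, add_mul, mul_neg,
    mul_assoc _ (expQ J _), mul_assoc _ (expQ J _)]

/-- The mean square oscillation of `g` over the interval from `α` to `β`. -/
noncomputable def meanSqOsc (g : ℝ → ℍ[ℝ]) (α β : ℝ) : ℝ :=
  (β - α)⁻¹ * ∫ θ in α..β, ‖g θ - (β - α)⁻¹ • ∫ t in α..β, g t‖ ^ 2

theorem meanSqOsc_nonneg (g : ℝ → ℍ[ℝ]) {α β : ℝ} (hαβ : α < β) : 0 ≤ meanSqOsc g α β :=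
  mul_nonneg (inv_nonneg.mpr (sub_nonneg.mpr hαβ.le))
    (intervalIntegral.integral_nonneg hαβ.le fun _ _ => by positivity)

theorem intervalIntegrable_norm_sub_sq {g : ℝ → ℍ[ℝ]} {α β : ℝ} (hαβ : α < β)
    (hg : MemLp g 2 (volume.restrict (Set.Ioc α β))) (v : ℍ[ℝ]) :
    IntervalIntegrable (fun θ => ‖g θ - v‖ ^ 2) volume α β := by
  rw [intervalIntegrable_iff_integrableOn_Ioc_of_le hαβ.le]
  exact (hg.sub (memLp_const v)).integrable_norm_pow two_ne_zero

theorem meanSqOsc_comp_neg (g : ℝ → ℍ[ℝ]) (α β : ℝ) :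
    meanSqOsc (fun θ => g (-θ)) α β = meanSqOsc g (-β) (-α) := by
  have h : -α - -β = β - α := by ring
  rw [meanSqOsc, intervalIntegral.integral_comp_neg g,
    intervalIntegral.integral_comp_neg fun θ => ‖g θ - (β - α)⁻¹ • ∫ t in -β..-α, g t‖ ^ 2,
    meanSqOsc, h]

theorem meanSqOsc_congr_ae {g h : ℝ → ℍ[ℝ]} (hgh : g =ᵐ[volume] h) (α β : ℝ) :
    meanSqOsc g α β = meanSqOsc h α β := by
  rw [meanSqOsc, meanSqOsc, intervalIntegral.integral_congr_ae (hgh.mono fun θ e _ => e)]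
  congr 1
  exact intervalIntegral.integral_congr_ae (hgh.mono fun θ e _ => by rw [e])

theorem meanSqOsc_mul_add_mul_le {A B : ℍ[ℝ]} (hA : ‖A‖ ≤ 1) (hB : ‖B‖ ≤ 1) {g h : ℝ → ℍ[ℝ]}
    {α β : ℝ} (hαβ : α < β) (hg : MemLp g 2 (volume.restrict (Set.Ioc α β)))
    (hh : MemLp h 2 (volume.restrict (Set.Ioc α β))) :
    meanSqOsc (fun θ => A * g θ + B * h θ) α β ≤
      2 * meanSqOsc g α β + 2 * meanSqOsc h α β := by
  have hgi : IntervalIntegrable g volume α β :=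
    (intervalIntegrable_iff_integrableOn_Ioc_of_le hαβ.le).mpr (hg.integrable one_le_two)
  have hhi : IntervalIntegrable h volume α β :=
    (intervalIntegrable_iff_integrableOn_Ioc_of_le hαβ.le).mpr (hh.integrable one_le_two)
  have hmean : (β - α)⁻¹ • ∫ t in α..β, (A * g t + B * h t) =
      A * ((β - α)⁻¹ • ∫ t in α..β, g t) + B * ((β - α)⁻¹ • ∫ t in α..β, h t) := by
    rw [intervalIntegral.integral_add (hgi.const_mul A) (hhi.const_mul B),
      intervalIntegral.integral_const_mul, intervalIntegral.integral_const_mul, smul_add,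
      mul_smul_comm, mul_smul_comm]
  unfold meanSqOsc
  rw [hmean]
  set u := (β - α)⁻¹ • ∫ t in α..β, g t
  set v := (β - α)⁻¹ • ∫ t in α..β, h t
  have hgsq := intervalIntegrable_norm_sub_sq hαβ hg u
  have hhsq := intervalIntegrable_norm_sub_sq hαβ hh v
  have hmem : MemLp (fun θ => A * g θ + B * h θ) 2 (volume.restrict (Set.Ioc α β)) :=
    (hg.const_mul A).add (hh.const_mul B)
  have hint : ∫ θ in α..β, ‖A * g θ + B * h θ - (A * u + B * v)‖ ^ 2 ≤
      2 * (∫ θ in α..β, ‖g θ - u‖ ^ 2) + 2 * ∫ θ in α..β, ‖h θ - v‖ ^ 2 := by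
    rw [← intervalIntegral.integral_const_mul, ← intervalIntegral.integral_const_mul,
      ← intervalIntegral.integral_add (hgsq.const_mul 2) (hhsq.const_mul 2)]
    refine intervalIntegral.integral_mono_on hαβ.le
      (intervalIntegrable_norm_sub_sq hαβ hmem _)
      ((hgsq.const_mul 2).add (hhsq.const_mul 2)) fun θ _ => ?_
    have h1 : ‖A * g θ + B * h θ - (A * u + B * v)‖ ≤ ‖g θ - u‖ + ‖h θ - v‖ := by
      rw [add_sub_add_comm, ← mul_sub, ← mul_sub]
      refine (norm_add_le _ _).trans ?_
      rw [norm_mul, norm_mul]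
      exact add_le_add (mul_le_of_le_one_left (norm_nonneg _) hA)
        (mul_le_of_le_one_left (norm_nonneg _) hB)
    exact (pow_le_pow_left₀ (norm_nonneg _) h1 2).trans
      (by nlinarith [sq_nonneg (‖g θ - u‖ - ‖h θ - v‖)])
  calc _ ≤ (β - α)⁻¹ * (2 * (∫ θ in α..β, ‖g θ - u‖ ^ 2) + 2 * ∫ θ in α..β, ‖h θ - v‖ ^ 2) :=
        mul_le_mul_of_nonneg_left hint (inv_nonneg.mpr (sub_nonneg.mpr hαβ.le))
    _ = _ := by ring

theorem meanSqOsc_le_sq_bmoSeminorm {g : ℝ → ℍ[ℝ]} (hg : bmoSeminorm g < ⊤) {α β : ℝ}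
    (hαβ : α < β) (hlen : β - α ≤ 2 * Real.pi) :
    meanSqOsc g α β ≤ (bmoSeminorm g).toReal ^ 2 := by
  have h : ENNReal.ofReal (meanSqOsc g α β ^ (1 / 2 : ℝ)) ≤ bmoSeminorm g :=
    le_iSup_of_le α (le_iSup_of_le β (le_iSup_of_le hαβ (le_iSup_of_le hlen le_rfl)))
  rw [ENNReal.ofReal_le_iff_le_toReal hg.ne, ← Real.sqrt_eq_rpow] at h
  exact (Real.sqrt_le_left ENNReal.toReal_nonneg).mp h

theorem bmoSeminorm_radial_limit_le {I J : ℍ[ℝ]} (hIre : I.re = 0) (hI : ‖I‖ = 1)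
    (hJre : J.re = 0) (hJ : ‖J‖ = 1) {a : ℕ → ℍ[ℝ]} (ha : Summable fun n => ‖a n‖ ^ 2)
    {g h : ℝ → ℍ[ℝ]}
    (hh : ∀ᵐ θ ∂(volume : Measure ℝ),
      Tendsto (fun r : ℝ => ∑' n : ℕ, (r • expQ I θ) ^ n * a n) (𝓝[<] (1 : ℝ)) (𝓝 (h θ)))
    (hg : ∀ᵐ θ ∂(volume : Measure ℝ),
      Tendsto (fun r : ℝ => ∑' n : ℕ, (r • expQ J θ) ^ n * a n) (𝓝[<] (1 : ℝ)) (𝓝 (g θ)))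
    (hfin : bmoSeminorm g < ⊤) : bmoSeminorm h ≤ 2 * bmoSeminorm g := by
  have hIJ : ‖I * J‖ = 1 := by rw [norm_mul, hI, hJ, one_mul]
  have hA : ‖(2⁻¹ : ℝ) • (1 - I * J)‖ ≤ 1 := by
    have := norm_sub_le 1 (I * J)
    rw [norm_smul, Real.norm_of_nonneg (by norm_num)]
    rw [norm_one, hIJ] at this
    linarith
  have hB : ‖(2⁻¹ : ℝ) • (1 + I * J)‖ ≤ 1 := by
    have := norm_add_le 1 (I * J)
    rw [norm_smul, Real.norm_of_nonneg (by norm_num)]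
    rw [norm_one, hIJ] at this
    linarith
  refine iSup_le fun α => iSup_le fun β => iSup_le fun hαβ => iSup_le fun hlen => ?_
  change ENNReal.ofReal (meanSqOsc h α β ^ (1 / 2 : ℝ)) ≤ _
  have hmem (s t : ℝ) (hst : t - s ≤ 2 * Real.pi) :
      MemLp g 2 (volume.restrict (Set.Ioc s t)) :=
    (memLp_two_of_radial_limit hJre hJ ha hg s).mono_measure
      (Measure.restrict_mono (Set.Ioc_subset_Ioc_right (by linarith)) le_rfl)
  have hmem_neg : MemLp (fun θ => g (-θ)) 2 (volume.restrict (Set.Ioc α β)) := by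
    have hpre := (Measure.measurePreserving_neg (volume : Measure ℝ)).restrict_preimage
      (measurableSet_Ico (a := -β) (b := -α))
    rw [Set.neg_preimage, Set.neg_Ico, neg_neg, neg_neg] at hpre
    have := hmem (-β) (-α) (by linarith)
    rw [← restrict_Ico_eq_restrict_Ioc] at this
    exact this.comp_measurePreserving hpre
  have hosc : meanSqOsc h α β ≤ (2 * (bmoSeminorm g).toReal) ^ 2 := by
    have h1 := meanSqOsc_le_sq_bmoSeminorm hfin hαβ hlen
    have h2 := meanSqOsc_le_sq_bmoSeminorm hfin (neg_lt_neg hαβ) (by linarith)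
    rw [meanSqOsc_congr_ae (radial_limit_representation hIre hI hJre hJ ha hh hg)]
    have h3 := meanSqOsc_mul_add_mul_le hA hB hαβ (hmem α β hlen) hmem_neg
    rw [meanSqOsc_comp_neg] at h3
    nlinarith
  rw [← Real.sqrt_eq_rpow]
  refine (ENNReal.ofReal_le_ofReal (Real.sqrt_le_iff.mpr ⟨by positivity, hosc⟩)).trans_eq ?_
  rw [ENNReal.ofReal_mul zero_le_two, ENNReal.ofReal_toReal hfin.ne, ENNReal.ofReal_ofNat]

/-- **BMOA on one slice controls BMOA on the whole ball.**
Let `f(q) = ∑ₙ qⁿ aₙ ∈ H²(𝔹)`, and for each imaginary unit `I` let `fstar I` be the a.e.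
radial boundary function of `f` on the slice `𝔹_I`. If `‖f‖_{BMOA(𝔹_{I₀})} < ∞` for some
imaginary unit `I₀`, then `‖f‖_{BMOA(𝔹)} = sup_{I} ‖f‖_{BMOA(𝔹_I)} < ∞`; moreover
`‖f‖_{BMOA(𝔹_{I₀})} ≤ ‖f‖_{BMOA(𝔹)} ≤ 2‖f‖_{BMOA(𝔹_{I₀})}`. -/
theorem bmoa_slice_implies_bmoa (a : ℕ → ℍ[ℝ]) (ha : Summable fun n => ‖a n‖ ^ 2)
    (fstar : ℍ[ℝ] → ℝ → ℍ[ℝ])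
    (hlim : ∀ I : ℍ[ℝ], I.re = 0 → ‖I‖ = 1 → ∀ᵐ θ ∂(volume : Measure ℝ),
      Tendsto (fun r : ℝ => ∑' n : ℕ, (r • expQ I θ) ^ n * a n) (𝓝[<] (1 : ℝ))
        (𝓝 (fstar I θ)))
    (I₀ : ℍ[ℝ]) (hI₀re : I₀.re = 0) (hI₀norm : ‖I₀‖ = 1)
    (hfin : bmoSeminorm (fstar I₀) < ⊤) :
    (⨆ (I : ℍ[ℝ]) (_ : I.re = 0 ∧ ‖I‖ = 1), bmoSeminorm (fstar I)) < ⊤ ∧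
    bmoSeminorm (fstar I₀) ≤ (⨆ (I : ℍ[ℝ]) (_ : I.re = 0 ∧ ‖I‖ = 1), bmoSeminorm (fstar I)) ∧
    (⨆ (I : ℍ[ℝ]) (_ : I.re = 0 ∧ ‖I‖ = 1), bmoSeminorm (fstar I))
      ≤ 2 * bmoSeminorm (fstar I₀) := by
  have hsup : (⨆ (I : ℍ[ℝ]) (_ : I.re = 0 ∧ ‖I‖ = 1), bmoSeminorm (fstar I))
      ≤ 2 * bmoSeminorm (fstar I₀) :=
    iSup₂_le fun I hI => bmoSeminorm_radial_limit_le hI.1 hI.2 hI₀re hI₀norm ha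
      (hlim I hI.1 hI.2) (hlim I₀ hI₀re hI₀norm) hfin
  exact ⟨hsup.trans_lt (ENNReal.mul_lt_top ENNReal.ofNat_lt_top hfin),
    le_iSup₂_of_le I₀ ⟨hI₀re, hI₀norm⟩ le_rfl, hsup⟩
end
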